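/- Let K ≥ 0 and s ≥ 0. Let g₁, g₂ : ℝ → ℝ be bounded Lipschitz functions, and let f : ℝ → ℝ be a continuous function such that (f(x) − f(y))·(x − y) ≤ K·(1 + |y|^s)·|x − y|² for all x, y ∈ ℝ. Then for every ε > 0 there exists a constant C (depending only on ε, K, s and on the sup-norms and Lipschitz constants of g₁, g₂) such that for all smooth compactly supported u, v : ℝ² → ℝ, writing w := u − v: −∫_{ℝ²}|∇w|² + ∫_{ℝ²} (g₁(u)·∂₁w + g₂(u)·∂₂w)·w + ∫_{ℝ²} ((g₁(u)−g₁(v))·∂₁v + (g₂(u)−g₂(v))·∂₂v)·w + ∫_{ℝ²} (f(u)−f(v))·w ≤ (ε − 1)·∫_{ℝ²}|∇w|² + C·(1 + ∫_{ℝ²}|∇v|² + ∫_{ℝ²}|v|^{2s})·∫_{ℝ²} w². -/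

import Mathlib

open MeasureTheory NNReal

theorem cs_aux {a b : EuclideanSpace ℝ (Fin 2) → ℝ} 
    (ha : Integrable (fun x => a x ^ 2)) (hb : Integrable (fun x => b x ^ 2))
    (hab : Integrable (fun x => a x * b x)) :
    (∫ x, a x * b x) ^ 2 ≤ (∫ x, a x ^ 2) * (∫ x, b x ^ 2) := by
  have h : ∀ t : ℝ, 0 ≤ (∫ x, a x ^ 2) * (t * t) + (2 * ∫ x, a x * b x) * t + ∫ x, b x ^ 2 := by
    intro t
    have h0 : 0 ≤ ∫ x, (t * a x + b x) ^ 2 := integral_nonneg fun x => sq_nonneg _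
    have h1 : ∫ x, (t * a x + b x) ^ 2
        = ∫ x, ((t * t) * a x ^ 2 + (2 * t) * (a x * b x) + b x ^ 2) := by
      congr 1; ext x; ring
    have i1 : Integrable (fun x => (t * t) * a x ^ 2 + (2 * t) * (a x * b x)) :=
      (ha.const_mul _).add (hab.const_mul _)
    rw [h1, integral_add i1 hb,
      integral_add (ha.const_mul _) (hab.const_mul _), integral_const_mul, integral_const_mul] at h0
    linarith
  have := discrim_le_zero h
  unfold discrim at this
  nlinarith

theorem norm_gradient_aux (w : EuclideanSpace ℝ (Fin 2) → ℝ) (x) :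
    ‖gradient w x‖ = ‖fderiv ℝ w x‖ := by
  simp [gradient]

theorem int_sq_aux {w : EuclideanSpace ℝ (Fin 2) → ℝ} (hw : Continuous w)
    (hws : HasCompactSupport w) : Integrable (fun x => w x ^ 2) := by
  have h1 : Continuous (fun x => w x ^ 2) := hw.pow 2
  have h2 : HasCompactSupport (fun x => w x ^ 2) :=
    hws.comp_left (g := fun y : ℝ => y ^ 2) (by simp)
  exact h1.integrable_of_hasCompactSupport h2

theorem int_mul_aux {a w : EuclideanSpace ℝ (Fin 2) → ℝ} (ha : Continuous a) (hw : Continuous w)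
    (hws : HasCompactSupport w) : Integrable (fun x => a x * w x) := by
  have h1 : Continuous (fun x => a x * w x) := ha.mul hw
  have h2 : HasCompactSupport (fun x => a x * w x) := hws.mul_left
  exact h1.integrable_of_hasCompactSupport h2

theorem hcs_norm_aux {F : Type*} [NormedAddCommGroup F] {w : EuclideanSpace ℝ (Fin 2) → F}
    (hws : HasCompactSupport w) : HasCompactSupport (fun x => ‖w x‖) :=
  hws.norm

theorem lady_aux : ∃ C : ℝ, 0 ≤ C ∧ ∀ w : EuclideanSpace ℝ (Fin 2) → ℝ,
    ContDiff ℝ 1 w → HasCompactSupport w →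
    ∫ x, (w x ^ 2) ^ 2 ≤ C * ((∫ x, w x ^ 2) * ∫ x, ‖fderiv ℝ w x‖ ^ 2) := by
  have hp : ((Module.finrank ℝ (EuclideanSpace ℝ (Fin 2)) : ℕ) : ℝ).HolderConjugate 2 := by
    simp only [finrank_euclideanSpace, Fintype.card_fin]
    exact_mod_cast Real.HolderConjugate.two_two
  obtain ⟨c, hc⟩ : ∃ c : ℝ≥0, ∀ w : EuclideanSpace ℝ (Fin 2) → ℝ, ContDiff ℝ 1 w →
      HasCompactSupport w → ∫⁻ x, ‖w x‖ₑ ^ (2:ℝ) ≤ c * (∫⁻ x, ‖fderiv ℝ w x‖ₑ) ^ (2:ℝ) :=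
    ⟨_, fun w hw hws => lintegral_pow_le_pow_lintegral_fderiv volume hw hws hp⟩
  refine ⟨4 * c, by positivity, fun w hw hws => ?_⟩
  have hw2 : ContDiff ℝ 1 (fun x => w x ^ 2) := hw.pow 2
  have hs2 : HasCompactSupport (fun x => w x ^ 2) := hws.comp_left (g := fun y => y ^ 2) (by simp)
  have key := hc _ hw2 hs2
  have hfc : Continuous (fderiv ℝ w) := hw.continuous_fderiv (by norm_num)
  have hfs : HasCompactSupport (fderiv ℝ w) := hws.fderiv ℝ
  have hgc : Continuous (fderiv ℝ (fun x => w x ^ 2)) := hw2.continuous_fderiv (by norm_num)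
  have hgs : HasCompactSupport (fderiv ℝ (fun x => w x ^ 2)) := hs2.fderiv ℝ
  have hgi : Integrable (fderiv ℝ (fun x => w x ^ 2)) := hgc.integrable_of_hasCompactSupport hgs
  have hfd : ∀ x, ‖fderiv ℝ (fun x => w x ^ 2) x‖ = 2 * (|w x| * ‖fderiv ℝ w x‖) := by
    intro x
    have hd : HasFDerivAt w (fderiv ℝ w x) x := (hw.differentiable (by norm_num) x).hasFDerivAt
    rw [(hd.pow 2).fderiv, norm_smul]
    simp [mul_assoc]
  have hi4 : Integrable (fun x => (w x ^ 2) ^ 2) :=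
    int_sq_aux hw2.continuous hs2
  have hl : ∫⁻ x, ‖w x ^ 2‖ₑ ^ (2:ℝ) = ENNReal.ofReal (∫ x, (w x ^ 2) ^ 2) := by
    rw [ofReal_integral_eq_lintegral_ofReal hi4 (Filter.Eventually.of_forall fun x => by positivity)]
    congr 1; ext x
    rw [ENNReal.ofReal_pow (by positivity), Real.enorm_eq_ofReal (by positivity)]
    norm_cast
  rw [hl, ← ofReal_integral_norm_eq_lintegral_enorm hgi] at key
  have key2 : ∫ x, (w x ^ 2) ^ 2 ≤ c * (∫ x, ‖fderiv ℝ (fun x => w x ^ 2) x‖) ^ 2 := by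
    have e : (c : ENNReal) = ENNReal.ofReal (c:ℝ) := by simp
    have hn : 0 ≤ ∫ x, ‖fderiv ℝ (fun x => w x ^ 2) x‖ := integral_nonneg fun x => norm_nonneg _
    rw [ENNReal.rpow_ofNat, ← ENNReal.ofReal_pow hn, e, ← ENNReal.ofReal_mul (by positivity)] at key
    exact (ENNReal.ofReal_le_ofReal_iff (by positivity)).1 key
  simp_rw [hfd] at key2
  rw [integral_const_mul] at key2
  have habs : HasCompactSupport (fun x => |w x|) :=
    hws.comp_left (g := fun y : ℝ => |y|) (by simp)
  have hac : Continuous (fun x => |w x|) := hw.continuous.abs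
  have hnc : Continuous (fun x => ‖fderiv ℝ w x‖) := hfc.norm
  have hns : HasCompactSupport (fun x => ‖fderiv ℝ w x‖) := hcs_norm_aux hfs
  have j1 : Integrable (fun x => |w x| ^ 2) := int_sq_aux hac habs
  have j2 : Integrable (fun x => ‖fderiv ℝ w x‖ ^ 2) := int_sq_aux hnc hns
  have j3 : Integrable (fun x => |w x| * ‖fderiv ℝ w x‖) := int_mul_aux hac hnc hns
  have hcs := cs_aux j1 j2 j3
  simp only [sq_abs] at hcs
  have h4 := mul_le_mul_of_nonneg_left hcs (show (0:ℝ) ≤ 4 * (c : ℝ) by positivity)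
  generalize (∫ x, |w x| * ‖fderiv ℝ w x‖) = I at *
  refine key2.trans (le_trans (le_of_eq ?_) h4)
  ring

theorem young_aux {ε L C P W G X : ℝ} (hε : 0 < ε) (hP : 0 ≤ P) (hC : 0 ≤ C) (hW : 0 ≤ W) (hG : 0 ≤ G)
    (h : X ^ 2 ≤ P * (C * (W * G))) : L * X ≤ ε / 4 * G + L ^ 2 * C / ε * (P * W) := by
  apply le_of_abs_le
  apply abs_le_of_sq_le_sq _ (by positivity)
  have h1 : (L * X) ^ 2 ≤ L ^ 2 * (P * (C * (W * G))) := by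
    rw [mul_pow]; exact mul_le_mul_of_nonneg_left h (sq_nonneg _)
  have h2 : L ^ 2 * (P * (C * (W * G))) = 4 * (ε / 4 * G) * (L ^ 2 * C / ε * (P * W)) := by
    field_simp
  nlinarith [sq_nonneg (ε / 4 * G - L ^ 2 * C / ε * (P * W))]

theorem pd_aux (w : EuclideanSpace ℝ (Fin 2) → ℝ) (x) (i : Fin 2) :
    |fderiv ℝ w x (EuclideanSpace.single i 1)| ≤ ‖fderiv ℝ w x‖ := by
  have := (fderiv ℝ w x).le_opNorm (EuclideanSpace.single i (1:ℝ))
  simpa using this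

theorem two_aux {a b p q N A B : ℝ} (ha : |a| ≤ A) (hb : |b| ≤ B) (hp : |p| ≤ N) (hq : |q| ≤ N) :
    |a * p + b * q| ≤ (A + B) * N := by
  have h1 : |a * p| ≤ A * N := by
    rw [abs_mul]; exact mul_le_mul ha hp (abs_nonneg _) ((abs_nonneg _).trans ha)
  have h2 : |b * q| ≤ B * N := by
    rw [abs_mul]; exact mul_le_mul hb hq (abs_nonneg _) ((abs_nonneg _).trans hb)
  have := abs_add_le (a * p) (b * q)
  linarith

/-- Local monotonicity estimate (7.4) for the semilinear drift operator of
Example 7.1 of the paper. -/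
theorem stmt_10 (K s : ℝ) (hK : 0 ≤ K) (hs : 0 ≤ s)
    (g₁ g₂ f : ℝ → ℝ)
    (hg₁b : ∃ M, ∀ x, |g₁ x| ≤ M) (hg₂b : ∃ M, ∀ x, |g₂ x| ≤ M)
    (hg₁l : ∃ L : ℝ≥0, LipschitzWith L g₁) (hg₂l : ∃ L : ℝ≥0, LipschitzWith L g₂)
    (hf : Continuous f)
    (hmon : ∀ x y : ℝ, (f x - f y) * (x - y) ≤ K * (1 + |y| ^ s) * |x - y| ^ 2) :
    ∀ ε : ℝ, 0 < ε → ∃ C : ℝ,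
      ∀ u v : EuclideanSpace ℝ (Fin 2) → ℝ,
        ContDiff ℝ (⊤ : ℕ∞) u → HasCompactSupport u → ContDiff ℝ (⊤ : ℕ∞) v → HasCompactSupport v →
        -(∫ x, ‖gradient (u - v) x‖ ^ 2)
            + (∫ x, (g₁ (u x) * fderiv ℝ (u - v) x (EuclideanSpace.single 0 1)
                + g₂ (u x) * fderiv ℝ (u - v) x (EuclideanSpace.single 1 1)) * (u x - v x))
            + (∫ x, ((g₁ (u x) - g₁ (v x)) * fderiv ℝ v x (EuclideanSpace.single 0 1)
                + (g₂ (u x) - g₂ (v x)) * fderiv ℝ v x (EuclideanSpace.single 1 1))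
                  * (u x - v x))
            + (∫ x, (f (u x) - f (v x)) * (u x - v x))
          ≤ (ε - 1) * (∫ x, ‖gradient (u - v) x‖ ^ 2)
            + C * (1 + (∫ x, ‖gradient v x‖ ^ 2) + (∫ x, |v x| ^ (2 * s)))
              * (∫ x, (u x - v x) ^ 2) := by
  obtain ⟨M₁, hM₁⟩ := hg₁b
  obtain ⟨M₂, hM₂⟩ := hg₂b
  obtain ⟨L₁, hL₁⟩ := hg₁l
  obtain ⟨L₂, hL₂⟩ := hg₂l
  obtain ⟨C₀, hC₀, lady⟩ := lady_aux
  intro ε hε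
  set M : ℝ := M₁ + M₂ with hM
  set L : ℝ := (L₁ : ℝ) + L₂ with hL
  refine ⟨M ^ 2 / ε + L ^ 2 * C₀ / ε + 2 * K + K ^ 2 * C₀ / ε, ?_⟩
  intro u v hu hus hv hvs
  simp only [norm_gradient_aux]
  obtain ⟨w, hw⟩ : ∃ w, w = u - v := ⟨_, rfl⟩
  have hwx : ∀ x, u x - v x = w x := fun x => by simp [hw]
  rw [← hw]
  simp only [hwx]
  have hwc : ContDiff ℝ 1 w := by rw [hw]; exact (hu.sub hv).of_le (by exact_mod_cast le_top)
  have hws : HasCompactSupport w := by rw [hw]; exact hus.sub hvs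
  have hvc : ContDiff ℝ 1 v := hv.of_le (by exact_mod_cast le_top)
  have hucont : Continuous u := hu.continuous
  have hvcont : Continuous v := hv.continuous
  have hwcont : Continuous w := hwc.continuous
  have hdw : Continuous (fderiv ℝ w) := hwc.continuous_fderiv (by norm_num)
  have hdv : Continuous (fderiv ℝ v) := hvc.continuous_fderiv (by norm_num)
  have hg1 := hL₁.continuous
  have hg2 := hL₂.continuous
  have hsw2 : HasCompactSupport (fun x => w x ^ 2) := hws.comp_left (g := fun y => y ^ 2) (by simp)
  have iW : Integrable (fun x => w x ^ 2) :=
    int_sq_aux hwcont hws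
  have iQ : Integrable (fun x => (w x ^ 2) ^ 2) :=
    int_sq_aux (hwcont.pow 2) hsw2
  have iG : Integrable (fun x => ‖fderiv ℝ w x‖ ^ 2) :=
    int_sq_aux hdw.norm (hcs_norm_aux (hws.fderiv ℝ))
  have iV : Integrable (fun x => ‖fderiv ℝ v x‖ ^ 2) :=
    int_sq_aux hdv.norm (hcs_norm_aux (hvs.fderiv ℝ))
  have iVw : Integrable (fun x => ‖fderiv ℝ v x‖ * w x ^ 2) :=
    int_mul_aux hdv.norm (hwcont.pow 2) hsw2
  have hlady := lady w hwc hws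
  have hW0 : 0 ≤ ∫ x, w x ^ 2 := integral_nonneg fun x => sq_nonneg _
  have hG0 : 0 ≤ ∫ x, ‖fderiv ℝ w x‖ ^ 2 := integral_nonneg fun x => sq_nonneg _
  have hV0 : 0 ≤ ∫ x, ‖fderiv ℝ v x‖ ^ 2 := integral_nonneg fun x => sq_nonneg _
  have hS0 : 0 ≤ ∫ x, |v x| ^ (2 * s) := integral_nonneg fun x => by positivity
  -- first term
  have T1 : (∫ x, (g₁ (u x) * fderiv ℝ w x (EuclideanSpace.single 0 1)
                + g₂ (u x) * fderiv ℝ w x (EuclideanSpace.single 1 1)) * w x)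
      ≤ ε / 4 * (∫ x, ‖fderiv ℝ w x‖ ^ 2) + M ^ 2 / ε * ∫ x, w x ^ 2 := by
    rw [← integral_const_mul, ← integral_const_mul,
      ← integral_add (iG.const_mul _) (iW.const_mul _)]
    refine integral_mono ?_ ((iG.const_mul _).add (iW.const_mul _)) fun x => ?_
    · refine int_mul_aux ?_ hwcont hws
      fun_prop
    · have h1 := two_aux (hM₁ (u x)) (hM₂ (u x)) (pd_aux w x 0) (pd_aux w x 1)
      have h2 : (g₁ (u x) * fderiv ℝ w x (EuclideanSpace.single 0 1)
                + g₂ (u x) * fderiv ℝ w x (EuclideanSpace.single 1 1)) * w x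
          ≤ M * ‖fderiv ℝ w x‖ * |w x| := by
        refine (le_abs_self _).trans ?_
        rw [abs_mul]
        exact mul_le_mul_of_nonneg_right h1 (abs_nonneg _)
      refine h2.trans ?_
      have h3 : 0 ≤ ε / 4 * (‖fderiv ℝ w x‖ - 2 * M / ε * |w x|) ^ 2 := by positivity
      have h4 : ε / 4 * (‖fderiv ℝ w x‖ - 2 * M / ε * |w x|) ^ 2
          = ε / 4 * ‖fderiv ℝ w x‖ ^ 2 + M ^ 2 / ε * w x ^ 2 - M * ‖fderiv ℝ w x‖ * |w x| := by
        rw [← sq_abs (w x)]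
        field_simp
        ring
      linarith
  -- second term
  have T2 : (∫ x, ((g₁ (u x) - g₁ (v x)) * fderiv ℝ v x (EuclideanSpace.single 0 1)
                + (g₂ (u x) - g₂ (v x)) * fderiv ℝ v x (EuclideanSpace.single 1 1)) * w x)
      ≤ L * ∫ x, ‖fderiv ℝ v x‖ * w x ^ 2 := by
    rw [← integral_const_mul]
    refine integral_mono ?_ (iVw.const_mul _) fun x => ?_
    · refine int_mul_aux ?_ hwcont hws
      fun_prop
    · have l1 : |g₁ (u x) - g₁ (v x)| ≤ L₁ * |w x| := by
        have := hL₁.dist_le_mul (u x) (v x)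
        rwa [Real.dist_eq, Real.dist_eq, hwx] at this
      have l2 : |g₂ (u x) - g₂ (v x)| ≤ L₂ * |w x| := by
        have := hL₂.dist_le_mul (u x) (v x)
        rwa [Real.dist_eq, Real.dist_eq, hwx] at this
      have h1 := two_aux l1 l2 (pd_aux v x 0) (pd_aux v x 1)
      have h2 := mul_le_mul_of_nonneg_right h1 (abs_nonneg (w x))
      rw [← abs_mul] at h2
      refine (le_abs_self _).trans (h2.trans (le_of_eq ?_))
      rw [← sq_abs (w x)]
      ring
  have T2' : L * (∫ x, ‖fderiv ℝ v x‖ * w x ^ 2) ≤ ε / 4 * (∫ x, ‖fderiv ℝ w x‖ ^ 2)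
      + L ^ 2 * C₀ / ε * ((∫ x, ‖fderiv ℝ v x‖ ^ 2) * ∫ x, w x ^ 2) :=
    young_aux hε hV0 hC₀ hW0 hG0
      ((cs_aux iV iQ iVw).trans (mul_le_mul_of_nonneg_left hlady hV0))
  -- third term
  have hsc : Continuous (fun x => |v x| ^ s) := hvcont.abs.rpow_const fun x => Or.inr hs
  have iSw : Integrable (fun x => |v x| ^ s * w x ^ 2) :=
    int_mul_aux hsc (hwcont.pow 2) hsw2
  have T3 : (∫ x, (f (u x) - f (v x)) * w x)
      ≤ K * (∫ x, w x ^ 2) + K * ∫ x, |v x| ^ s * w x ^ 2 := by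
    rw [← integral_const_mul, ← integral_const_mul,
      ← integral_add (iW.const_mul _) (iSw.const_mul _)]
    refine integral_mono ?_ ((iW.const_mul _).add (iSw.const_mul _)) fun x => ?_
    · refine int_mul_aux ?_ hwcont hws
      fun_prop
    · have := hmon (u x) (v x)
      rw [hwx, sq_abs] at this
      refine this.trans (le_of_eq ?_)
      ring
  have T3' : K * (∫ x, |v x| ^ s * w x ^ 2) ≤ ε / 4 * (∫ x, ‖fderiv ℝ w x‖ ^ 2)
      + K ^ 2 * C₀ / ε * ((∫ x, |v x| ^ (2 * s)) * ∫ x, w x ^ 2) + K * ∫ x, w x ^ 2 := by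
    rcases hs.eq_or_lt with h0 | hpos
    · have e : ∫ x, |v x| ^ s * w x ^ 2 = ∫ x, w x ^ 2 := by simp [← h0]
      rw [e]
      have : 0 ≤ ε / 4 * (∫ x, ‖fderiv ℝ w x‖ ^ 2)
        + K ^ 2 * C₀ / ε * ((∫ x, |v x| ^ (2 * s)) * ∫ x, w x ^ 2) := by positivity
      linarith
    · have e : ∀ x, |v x| ^ (2 * s) = (|v x| ^ s) ^ 2 := fun x => by
        rw [mul_comm, Real.rpow_mul (abs_nonneg _), Real.rpow_two]
      have iS : Integrable (fun x => (|v x| ^ s) ^ 2) :=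
        int_sq_aux hsc
          (hvs.comp_left (g := fun y : ℝ => |y| ^ s) (by simp [Real.zero_rpow hpos.ne']))
      simp only [e] at hS0 ⊢
      have := young_aux (L := K) hε hS0 hC₀ hW0 hG0
        ((cs_aux iS iQ iSw).trans (mul_le_mul_of_nonneg_left hlady hS0))
      have h2 : 0 ≤ K * ∫ x, w x ^ 2 := by positivity
      linarith
  generalize (∫ x, ‖fderiv ℝ w x‖ ^ 2) = G at *
  generalize (∫ x, ‖fderiv ℝ v x‖ ^ 2) = V at *
  generalize (∫ x, |v x| ^ (2 * s)) = S at *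
  generalize (∫ x, w x ^ 2) = W at *
  have hA : 0 ≤ M ^ 2 / ε := by positivity
  have hB : 0 ≤ L ^ 2 * C₀ / ε := by positivity
  have hD : 0 ≤ K ^ 2 * C₀ / ε := by positivity
  generalize M ^ 2 / ε = A at *
  generalize L ^ 2 * C₀ / ε = B at *
  generalize K ^ 2 * C₀ / ε = D at *
  have hr : 0 ≤ ε / 4 * G + (A + 2 * K + D) * (V * W) + (A + B + 2 * K) * (S * W)
      + (B + D) * W := by positivity
  linarith
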